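/- Suppose A is Γ-graded D-simple, and suppose dim_{F₁} 𝒟 > 1 or 𝒟 ≠ 𝒟₋ (where 𝒟₋ is the span of the homogeneous elements of 𝒟 whose degrees lie in Γ₋). Then for every homogeneous color-derivation ∂ ∈ 𝒟 one has A∂ ⊆ W, where W = [A[D],A[D]]. -/

import Mathlib

/-- A skew-symmetric bicharacter `ε : Γ × Γ → F^×`. -/
def IsBichar {F : Type} [Field F] {Γ : Type} [AddCommGroup Γ] (ε : Γ → Γ → F) : Prop :=
  (∀ lam mu, ε lam mu * ε mu lam = 1) ∧
  (∀ lam mu nu, ε lam (mu + nu) = ε lam mu * ε lam nu)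

variable (F : Type) [Field F] (Γ : Type) [AddCommGroup Γ] [DecidableEq Γ]
  (A : Type) [Ring A] [Algebra F A]

/-- left multiplication operators -/
noncomputable def mulL : A →ₗ[F] Module.End F A := (Algebra.lmul F A).toLinearMap

variable {F Γ A}

/-- `f ∈ End_F(A)` is homogeneous of degree `δ`. -/
def IsHomogMap (𝒜 : Γ → Submodule F A) (δ : Γ) (f : Module.End F A) : Prop :=
  ∀ lam : Γ, ∀ a ∈ 𝒜 lam, f a ∈ 𝒜 (lam + δ)

/-- `f` is a homogeneous color-derivation of degree `δ`. -/
def IsColorDer (𝒜 : Γ → Submodule F A) (ε : Γ → Γ → F) (δ : Γ) (f : Module.End F A) : Prop :=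
  IsHomogMap 𝒜 δ f ∧
  ∀ lam : Γ, ∀ a ∈ 𝒜 lam, ∀ b : A, f (a * b) = f a * b + ε δ lam • (a * f b)

/-- `Der^ε(A)`: the F-span of homogeneous color derivations. -/
def DerE (𝒜 : Γ → Submodule F A) (ε : Γ → Γ → F) : Submodule F (Module.End F A) :=
  Submodule.span F {f | ∃ δ, IsColorDer 𝒜 ε δ f}

/-- `A` is ε-commutative. -/
def IsColorComm (𝒜 : Γ → Submodule F A) (ε : Γ → Γ → F) : Prop :=
  ∀ lam mu : Γ, ∀ a ∈ 𝒜 lam, ∀ b ∈ 𝒜 mu, a * b = ε lam mu • (b * a)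

/-- `D` is color-commutative. -/
def DColorComm (𝒜 : Γ → Submodule F A) (ε : Γ → Γ → F) (D : Submodule F (Module.End F A)) : Prop :=
  ∀ δ δ' f g, f ∈ D → g ∈ D → IsColorDer 𝒜 ε δ f → IsColorDer 𝒜 ε δ' g →
    f * g = ε δ δ' • (g * f)

/-- `D` is a Γ-graded subspace: it is spanned by its homogeneous color-derivations. -/
def DGraded (𝒜 : Γ → Submodule F A) (ε : Γ → Γ → F) (D : Submodule F (Module.End F A)) : Prop :=
  D = Submodule.span F {f | f ∈ D ∧ ∃ δ, IsColorDer 𝒜 ε δ f}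

/-- `A[D]`: the unital subalgebra of `End_F(A)` generated by left multiplications and `D`. -/
noncomputable def AD (D : Submodule F (Module.End F A)) : Subalgebra F (Module.End F A) :=
  Algebra.adjoin F (Set.range (mulL F A) ∪ (D : Set (Module.End F A)))

/-- `A` is Γ-graded `D`-simple. -/
def GradedDSimple (𝒜 : Γ → Submodule F A) [GradedAlgebra 𝒜] (D : Submodule F (Module.End F A)) :
    Prop :=
  ∀ I : Ideal A, Ideal.IsHomogeneous 𝒜 I → (∀ f ∈ D, ∀ x ∈ I, f x ∈ I) → I = ⊥ ∨ I = ⊤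

/-- F₁ = A^D -/
def F1 (D : Submodule F (Module.End F A)) : Submodule F A where
  carrier := {u | ∀ f ∈ D, f u = 0}
  add_mem' := by
    intro a b ha hb f hf
    rw [map_add, ha f hf, hb f hf, add_zero]
  zero_mem' := by intro f hf; exact map_zero f
  smul_mem' := by
    intro c x hx f hf
    rw [map_smul, hx f hf, smul_zero]

/-- the derived space `W = [A[D], A[D]]`. -/
def Wsub (𝒜 : Γ → Submodule F A) (ε : Γ → Γ → F) (D : Submodule F (Module.End F A)) :
    Submodule F (Module.End F A) :=
  Submodule.span F {w | ∃ γ γ' x y, x ∈ AD D ∧ y ∈ AD D ∧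
    IsHomogMap 𝒜 γ x ∧ IsHomogMap 𝒜 γ' y ∧ w = x * y - ε γ γ' • (y * x)}

/-- `F₁[D]`. -/
noncomputable def F1D (D : Submodule F (Module.End F A)) : Subalgebra F (Module.End F A) :=
  Algebra.adjoin F ((mulL F A '' (F1 D : Set A)) ∪ (D : Set (Module.End F A)))

/-- `𝒟 = Der^ε(A) ∩ F₁[D]`. -/
def DScr (𝒜 : Γ → Submodule F A) (ε : Γ → Γ → F) (D : Submodule F (Module.End F A)) :
    Set (Module.End F A) :=
  {f | f ∈ F1D D ∧ f ∈ DerE 𝒜 ε}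

variable {I : Type} [LinearOrder I]

/-- ordered product `d^α`. -/
noncomputable def dpow (d : I → Module.End F A) (α : I →₀ ℕ) : Module.End F A :=
  ((α.support.sort (· ≤ ·)).map fun i => d i ^ α i).prod

/-- membership in the index set 𝒥. -/
def inJ (ε : Γ → Γ → F) (δd : I → Γ) (α : I →₀ ℕ) : Prop :=
  (∀ i, ringChar F ≠ 0 → α i ≤ ringChar F - 1) ∧
  (∀ i, ε (δd i) (δd i) = -1 → α i ≤ 1)

/-- the degree of `d^α`. -/
def degJ (δd : I → Γ) (α : I →₀ ℕ) : Γ := α.sum fun i n => n • δd i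

/-- the subalgebra `S` of `End_F(A)` is Γ-graded simple. -/
def GradedSimpleAlgOn (𝒜 : Γ → Submodule F A) (S : Subalgebra F (Module.End F A)) : Prop :=
  ∀ L : Submodule F (Module.End F A),
    L ≤ Subalgebra.toSubmodule S →
    (∀ x ∈ S, ∀ y ∈ L, x * y ∈ L ∧ y * x ∈ L) →
    L = Submodule.span F {f | f ∈ L ∧ ∃ δ, IsHomogMap 𝒜 δ f} →
    (L = ⊥ ∨ L = Subalgebra.toSubmodule S)

/-- variant of 𝒥 without characteristic restriction -/
def inJ0 (ε : Γ → Γ → F) (δd : I → Γ) (α : I →₀ ℕ) : Prop :=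
  ∀ i, ε (δd i) (δd i) = -1 → α i ≤ 1

/-- the sum `Σ_{α ∈ J0} B d^α` is direct -/
def DirectOn (d : I → Module.End F A) (J0 : Set (I →₀ ℕ)) (Bs : Set A) : Prop :=
  ∀ (s : Finset (I →₀ ℕ)) (c : (I →₀ ℕ) → A), ↑s ⊆ J0 → (∀ α ∈ s, c α ∈ Bs) →
    (∑ α ∈ s, mulL F A (c α) * dpow d α) = 0 → ∀ α ∈ s, mulL F A (c α) * dpow d α = 0

/-- span of color brackets of homogeneous elements of `M` and `N` -/
def brkE (𝒜 : Γ → Submodule F A) (ε : Γ → Γ → F) (M N : Submodule F (Module.End F A)) :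
    Submodule F (Module.End F A) :=
  Submodule.span F {w | ∃ γ γ' x y, x ∈ M ∧ y ∈ N ∧
    IsHomogMap 𝒜 γ x ∧ IsHomogMap 𝒜 γ' y ∧ w = x * y - ε γ γ' • (y * x)}

/-! ### A rank condition for algebras generated by quasi-commuting elements -/

section QuasiCommuting

variable {ι : Type} {R : Type} [Ring R] [Algebra F R]

/-- The monomial `∏ t i ^ α i`, the factors being taken in the order of the list `l`. -/
def listMonomial (t : ι → R) (l : List ι) (α : ι → ℕ) : R :=
  (l.map fun i => t i ^ α i).prod

theorem pow_mul_of_quasiCommute {x y : R} {q : F} (h : x * y = q • (y * x)) (n : ℕ) :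
    x ^ n * y = q ^ n • (y * x ^ n) := by
  induction n with
  | zero => simp
  | succ n ih =>
    rw [pow_succ, mul_assoc, h, mul_smul_comm, ← mul_assoc, ih, smul_mul_assoc, smul_smul,
      mul_assoc, ← pow_succ']

theorem listMonomial_mul_swap {t : ι → R} {q : ι → ι → F}
    (ht : ∀ i j, t i * t j = q i j • (t j * t i)) (j : ι) (α : ι → ℕ) (l : List ι) :
    ∃ c : F, listMonomial t l α * t j = c • (t j * listMonomial t l α) := by
  induction l with
  | nil => exact ⟨1, by simp [listMonomial]⟩
  | cons i l ih =>
    obtain ⟨c, hc⟩ := ih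
    refine ⟨c * q i j ^ α i, ?_⟩
    simp only [listMonomial, List.map_cons, List.prod_cons] at hc ⊢
    rw [mul_assoc, hc, mul_smul_comm, ← mul_assoc, pow_mul_of_quasiCommute (ht i j),
      smul_mul_assoc, smul_smul, mul_assoc]

theorem listMonomial_mul [DecidableEq ι] {t : ι → R} {q : ι → ι → F}
    (ht : ∀ i j, t i * t j = q i j • (t j * t i)) (j : ι) (α : ι → ℕ) {l : List ι}
    (hl : l.Nodup) (hj : j ∈ l) :
    ∃ c : F, listMonomial t l α * t j =
      c • listMonomial t l (Function.update α j (α j + 1)) := by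
  induction l with
  | nil => simp at hj
  | cons i l ih =>
    rw [List.nodup_cons] at hl
    by_cases hij : i = j
    · subst hij
      obtain ⟨c, hc⟩ := listMonomial_mul_swap ht i α l
      have hcongr : (l.map fun k => t k ^ Function.update α i (α i + 1) k) =
          l.map fun k => t k ^ α k := by
        refine List.map_congr_left fun k hk => ?_
        rw [Function.update_of_ne (ne_of_mem_of_not_mem hk hl.1)]
      refine ⟨c, ?_⟩
      simp only [listMonomial, List.map_cons, List.prod_cons] at hc ⊢
      rw [hcongr, mul_assoc, hc, mul_smul_comm, ← mul_assoc, Function.update_self, pow_succ]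
    · obtain ⟨c, hc⟩ := ih hl.2 ((List.mem_cons.1 hj).resolve_left (Ne.symm hij))
      refine ⟨c, ?_⟩
      simp only [listMonomial, List.map_cons, List.prod_cons] at hc ⊢
      rw [mul_assoc, hc, mul_smul_comm, Function.update_of_ne hij]

/-- The span of the monomials in all `t i` with every exponent at most `n`. -/
noncomputable def monomialSpan (F : Type) [Field F] {ι R : Type} [Ring R] [Algebra F R] [Fintype ι]
    (t : ι → R) (n : ℕ) : Submodule F R :=
  Submodule.span F (Set.range fun α : ι → Fin (n + 1) =>
    listMonomial t Finset.univ.toList fun i => (α i : ℕ))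

theorem finrank_monomialSpan_le [Fintype ι] (t : ι → R) (n : ℕ) :
    Module.finrank F (monomialSpan F t n) ≤ (n + 1) ^ Fintype.card ι := by
  classical
  refine (finrank_range_le_card _).trans ?_
  simp

theorem mul_mem_monomialSpan [Fintype ι] {t : ι → R} {q : ι → ι → F}
    (ht : ∀ i j, t i * t j = q i j • (t j * t i)) {n : ℕ} {x c : R}
    (hx : x ∈ monomialSpan F t n) (hc : c ∈ Submodule.span F (Set.range t)) :
    x * c ∈ monomialSpan F t (n + 1) := by
  classical
  induction hc using Submodule.span_induction with
  | zero => simp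
  | add a b _ _ ha hb => rw [mul_add]; exact add_mem ha hb
  | smul r a _ ha => rw [mul_smul_comm]; exact Submodule.smul_mem _ _ ha
  | mem a ha =>
    obtain ⟨j, rfl⟩ := ha
    induction hx using Submodule.span_induction with
    | zero => simp
    | add a b _ _ ha hb => rw [add_mul]; exact add_mem ha hb
    | smul r a _ ha => rw [smul_mul_assoc]; exact Submodule.smul_mem _ _ ha
    | mem a ha =>
      obtain ⟨α, rfl⟩ := ha
      obtain ⟨c, hc⟩ := listMonomial_mul ht j (fun i => (α i : ℕ))
        (Finset.nodup_toList Finset.univ) (by simp)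
      simp only [hc]
      refine Submodule.smul_mem _ _ (Submodule.subset_span ⟨fun i =>
        ⟨Function.update (fun i => (α i : ℕ)) j (α j + 1) i, ?_⟩, rfl⟩)
      rcases eq_or_ne i j with rfl | hij
      · rw [Function.update_self]; have := (α i).2; omega
      · rw [Function.update_of_ne hij]; have := (α i).2; omega

theorem exists_pow_lt_two_pow (m : ℕ) : ∃ n : ℕ, (n + 1) ^ m < 2 ^ n := by
  have h := tendsto_pow_const_div_const_pow_of_one_lt m (show (1 : ℝ) < 2 by norm_num)
  have h1 := (h.eventually (gt_mem_nhds (show (0 : ℝ) < 1 / 2 by norm_num))).exists_forall_of_atTop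
  obtain ⟨N, hN⟩ := h1
  refine ⟨N, ?_⟩
  have h2 := hN (N + 1) (by omega)
  rw [div_lt_iff₀ (by positivity), pow_succ] at h2
  have h3 : ((N + 1 : ℕ) : ℝ) ^ m < 2 ^ N := by linarith
  exact_mod_cast h3

/-- In an algebra generated by finitely many elements commuting up to scalars, two linear forms in
the generators satisfy a nontrivial left linear relation. -/
theorem exists_left_relation [Nontrivial R] [Fintype ι] {t : ι → R} {q : ι → ι → F}
    (ht : ∀ i j, t i * t j = q i j • (t j * t i)) {c₁ c₂ : R}
    (h₁ : c₁ ∈ Submodule.span F (Set.range t)) (h₂ : c₂ ∈ Submodule.span F (Set.range t)) :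
    ∃ n, ∃ x ∈ monomialSpan F t n, ∃ y ∈ monomialSpan F t n,
      x * c₁ + y * c₂ = 0 ∧ ¬(x = 0 ∧ y = 0) := by
  by_contra! hcon
  have hfin : ∀ n, Module.Finite F (monomialSpan F t n) := fun n =>
    Module.Finite.span_of_finite F (Set.finite_range _)
  have hstep : ∀ n, 2 * Module.finrank F (monomialSpan F t n) ≤
      Module.finrank F (monomialSpan F t (n + 1)) := by
    intro n
    have := hfin n
    have := hfin (n + 1)
    let φ : (monomialSpan F t n × monomialSpan F t n) →ₗ[F] R :=
      ((LinearMap.mulRight F c₁).comp (monomialSpan F t n).subtype).coprod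
        ((LinearMap.mulRight F c₂).comp (monomialSpan F t n).subtype)
    let ψ := φ.codRestrict (monomialSpan F t (n + 1)) fun p =>
      add_mem (mul_mem_monomialSpan ht p.1.2 h₁) (mul_mem_monomialSpan ht p.2.2 h₂)
    have hψ : Function.Injective ψ := by
      rw [injective_iff_map_eq_zero]
      rintro ⟨⟨x, hx⟩, ⟨y, hy⟩⟩ h
      have h' : x * c₁ + y * c₂ = 0 := congrArg Subtype.val h
      obtain ⟨rfl, rfl⟩ := hcon n x hx y hy h'
      rfl
    have := LinearMap.finrank_le_finrank_of_injective hψ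
    rw [Module.finrank_prod] at this
    omega
  have hpow : ∀ n, 2 ^ n ≤ Module.finrank F (monomialSpan F t n) := by
    intro n
    induction n with
    | zero =>
      have := hfin 0
      have h1 : (1 : R) ∈ monomialSpan F t 0 :=
        Submodule.subset_span ⟨0, by simp [listMonomial]⟩
      have : Nontrivial (monomialSpan F t 0) :=
        ⟨⟨1, h1⟩, 0, fun h => one_ne_zero (congrArg Subtype.val h)⟩
      exact Module.finrank_pos
    | succ n ih => have := hstep n; rw [pow_succ]; omega
  obtain ⟨n, hn⟩ := exists_pow_lt_two_pow (Fintype.card ι)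
  exact absurd ((hpow n).trans (finrank_monomialSpan_le t n)) (not_le.2 hn)

end QuasiCommuting

/-! ### Bicharacters -/

section Bicharacter

variable {Λ : Type} [AddCommGroup Λ] {ε : Λ → Λ → F}

theorem IsBichar.ne_zero (h : IsBichar ε) (a b : Λ) : ε a b ≠ 0 :=
  left_ne_zero_of_mul_eq_one (h.1 a b)

theorem IsBichar.add_left (h : IsBichar ε) (a b c : Λ) : ε (a + b) c = ε a c * ε b c := by
  have h0 := h.ne_zero c (a + b)
  apply mul_right_cancel₀ h0
  rw [h.1, h.2, mul_mul_mul_comm, h.1, h.1, one_mul]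

theorem IsBichar.zero_right (h : IsBichar ε) (a : Λ) : ε a 0 = 1 := by
  have h1 := h.2 a 0 0
  rw [add_zero] at h1
  exact (mul_left_cancel₀ (h.ne_zero a 0) (by rw [mul_one]; exact h1)).symm

theorem IsBichar.zero_left (h : IsBichar ε) (a : Λ) : ε 0 a = 1 := by
  have h1 := h.1 0 a
  rwa [h.zero_right, mul_one] at h1

end Bicharacter

/-! ### Homogeneous components -/

section Components

variable (𝒜 : Γ → Submodule F A) [GradedAlgebra 𝒜]

/-- The additive projection onto the component of degree `l`. -/
noncomputable def component (l : Γ) : A →ₗ[F] A := GradedAlgebra.proj 𝒜 l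

variable {𝒜}

theorem component_mem (l : Γ) (a : A) : component 𝒜 l a ∈ 𝒜 l := SetLike.coe_mem _

theorem component_same {l : Γ} {a : A} (ha : a ∈ 𝒜 l) : component 𝒜 l a = a :=
  DirectSum.decompose_of_mem_same 𝒜 ha

theorem component_ne {l m : Γ} {a : A} (ha : a ∈ 𝒜 l) (h : l ≠ m) : component 𝒜 m a = 0 :=
  DirectSum.decompose_of_mem_ne 𝒜 ha h

theorem homogeneous_induction {p : A → Prop} (hom : ∀ l, ∀ a ∈ 𝒜 l, p a)
    (add : ∀ a b, p a → p b → p (a + b)) (a : A) : p a :=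
  DirectSum.Decomposition.inductionOn 𝒜 (hom 0 0 (zero_mem _)) (fun {l} m => hom l m m.2) add a

theorem homogeneous_ext {M : Type} [AddCommMonoid M] [Module F M] {f g : A →ₗ[F] M}
    (h : ∀ l, ∀ a ∈ 𝒜 l, f a = g a) : f = g := by
  ext a
  induction a using homogeneous_induction (𝒜 := 𝒜) with
  | hom l a ha => exact h l a ha
  | add a b ha hb => rw [map_add, map_add, ha, hb]

theorem exists_sum_component (a : A) : ∃ s : Finset Γ, ∑ l ∈ s, component 𝒜 l a = a := by
  classical
  exact ⟨_, DirectSum.sum_support_decompose 𝒜 a⟩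

theorem IsHomogMap.component_apply {δ : Γ} {f : Module.End F A} (hf : IsHomogMap 𝒜 δ f)
    (l : Γ) (a : A) : component 𝒜 (l + δ) (f a) = f (component 𝒜 l a) := by
  induction a using homogeneous_induction (𝒜 := 𝒜) with
  | hom m a ha =>
    rcases eq_or_ne m l with rfl | h
    · rw [component_same ha, component_same (hf _ _ ha)]
    · rw [component_ne ha h, component_ne (hf _ _ ha) (fun h' => h (add_right_cancel h')), map_zero]
  | add a b ha hb => simp only [map_add, ha, hb]

theorem decomposeLinearEquiv_of_mem {l : Γ} {a : A} (ha : a ∈ 𝒜 l) :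
    DirectSum.decomposeLinearEquiv 𝒜 a = DirectSum.lof F Γ (fun l => 𝒜 l) l ⟨a, ha⟩ :=
  DirectSum.decompose_of_mem 𝒜 ha

variable (𝒜) in
/-- The homogeneous component of degree `γ` of an endomorphism. -/
noncomputable def endComponent (γ : Γ) : Module.End F A →ₗ[F] Module.End F A where
  toFun f := (DirectSum.toModule F Γ A fun l =>
    component 𝒜 (l + γ) ∘ₗ f ∘ₗ (𝒜 l).subtype) ∘ₗ (DirectSum.decomposeLinearEquiv 𝒜).toLinearMap
  map_add' f g := by
    refine homogeneous_ext (𝒜 := 𝒜) fun l a ha => ?_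
    simp [decomposeLinearEquiv_of_mem ha]
  map_smul' c f := by
    refine homogeneous_ext (𝒜 := 𝒜) fun l a ha => ?_
    simp [decomposeLinearEquiv_of_mem ha]

theorem endComponent_apply (γ : Γ) (f : Module.End F A) {l : Γ} {a : A} (ha : a ∈ 𝒜 l) :
    endComponent 𝒜 γ f a = component 𝒜 (l + γ) (f a) := by
  simp [endComponent, decomposeLinearEquiv_of_mem ha]

theorem endComponent_same {γ : Γ} {f : Module.End F A} (hf : IsHomogMap 𝒜 γ f) :
    endComponent 𝒜 γ f = f :=
  homogeneous_ext (𝒜 := 𝒜) fun l a ha => by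
    rw [endComponent_apply γ f ha, component_same (hf l a ha)]

theorem endComponent_ne {γ δ : Γ} {f : Module.End F A} (hf : IsHomogMap 𝒜 γ f) (h : γ ≠ δ) :
    endComponent 𝒜 δ f = 0 :=
  homogeneous_ext (𝒜 := 𝒜) fun l a ha => by
    rw [endComponent_apply δ f ha, component_ne (hf l a ha) (fun h' => h (add_left_cancel h'))]
    rfl

/-- The degree `γ` component of an element of a span of homogeneous elements lies in the span of
those of degree `γ`. -/
theorem endComponent_mem_span {P : Set (Γ × Module.End F A)}
    (hP : ∀ p ∈ P, IsHomogMap 𝒜 p.1 p.2) (γ : Γ) {f : Module.End F A}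
    (hf : f ∈ Submodule.span F (Prod.snd '' P)) :
    endComponent 𝒜 γ f ∈ Submodule.span F {g | (γ, g) ∈ P} := by
  induction hf using Submodule.span_induction with
  | zero => simp
  | add a b _ _ ha hb => rw [map_add]; exact add_mem ha hb
  | smul r a _ ha => rw [map_smul]; exact Submodule.smul_mem _ _ ha
  | mem a ha =>
    obtain ⟨⟨δ, g⟩, hg, rfl⟩ := ha
    rcases eq_or_ne δ γ with rfl | h
    · rw [endComponent_same (hP _ hg)]; exact Submodule.subset_span hg
    · rw [endComponent_ne (hP _ hg) h]; exact zero_mem _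

theorem exists_sum_endComponent {P : Set (Γ × Module.End F A)}
    (hP : ∀ p ∈ P, IsHomogMap 𝒜 p.1 p.2) {f : Module.End F A}
    (hf : f ∈ Submodule.span F (Prod.snd '' P)) :
    ∃ s : Finset Γ, ∑ γ ∈ s, endComponent 𝒜 γ f = f := by
  suffices h : ∃ s : Finset Γ, ∀ t, s ⊆ t → ∑ γ ∈ t, endComponent 𝒜 γ f = f by
    obtain ⟨s, hs⟩ := h
    exact ⟨s, hs s subset_rfl⟩
  induction hf using Submodule.span_induction with
  | zero => exact ⟨∅, by simp⟩
  | add a b _ _ ha hb =>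
    obtain ⟨s, hs⟩ := ha
    obtain ⟨s', hs'⟩ := hb
    refine ⟨s ∪ s', fun t ht => ?_⟩
    simp only [map_add, Finset.sum_add_distrib]
    rw [hs t (Finset.union_subset_left ht), hs' t (Finset.union_subset_right ht)]
  | smul r a _ ha =>
    obtain ⟨s, hs⟩ := ha
    refine ⟨s, fun t ht => ?_⟩
    simp only [map_smul, ← Finset.smul_sum]
    rw [hs t ht]
  | mem a ha =>
    obtain ⟨⟨δ, g⟩, hg, rfl⟩ := ha
    refine ⟨{δ}, fun t ht => ?_⟩
    rw [Finset.sum_eq_single_of_mem δ (ht (Finset.mem_singleton_self δ)), endComponent_same (hP _ hg)]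
    exact fun γ _ h => endComponent_ne (hP _ hg) h.symm

end Components

set_option linter.unusedSectionVars false

/-! ### Left multiplications and color derivations -/

section Operators

variable {𝒜 : Γ → Submodule F A} {ε : Γ → Γ → F} {D : Submodule F (Module.End F A)}

theorem mulL_apply {F A : Type} [Field F] [Ring A] [Algebra F A] (a b : A) :
    mulL F A a b = a * b := rfl

theorem mulL_mul {F A : Type} [Field F] [Ring A] [Algebra F A] (a b : A) :
    mulL F A (a * b) = mulL F A a * mulL F A b :=
  map_mul (Algebra.lmul F A) a b

theorem IsHomogMap.one : IsHomogMap 𝒜 0 (1 : Module.End F A) := fun l a ha => by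
  rwa [add_zero]

theorem IsHomogMap.mul {γ δ : Γ} {x y : Module.End F A} (hx : IsHomogMap 𝒜 γ x)
    (hy : IsHomogMap 𝒜 δ y) : IsHomogMap 𝒜 (γ + δ) (x * y) := fun l a ha => by
  have h := hx _ _ (hy l a ha)
  rwa [add_assoc, add_comm δ γ] at h

theorem isHomogMap_mulL [GradedAlgebra 𝒜] {l : Γ} {a : A} (ha : a ∈ 𝒜 l) :
    IsHomogMap 𝒜 l (mulL F A a) := fun m b hb => by
  rw [add_comm]; exact SetLike.mul_mem_graded ha hb

theorem mulL_mul_mulL (hcomm : IsColorComm 𝒜 ε) {l m : Γ} {a b : A} (ha : a ∈ 𝒜 l)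
    (hb : b ∈ 𝒜 m) : mulL F A a * mulL F A b = ε l m • (mulL F A b * mulL F A a) := by
  rw [← mulL_mul, ← mulL_mul, ← map_smul, hcomm l m a ha b hb]

theorem IsColorDer.mul_mulL {δ l : Γ} {f : Module.End F A} (hf : IsColorDer 𝒜 ε δ f) {a : A}
    (ha : a ∈ 𝒜 l) : f * mulL F A a = mulL F A (f a) + ε δ l • (mulL F A a * f) := by
  ext b
  exact hf.2 l a ha b

theorem IsColorDer.map_one [GradedAlgebra 𝒜] (hbich : IsBichar ε) {δ : Γ} {f : Module.End F A}
    (hf : IsColorDer 𝒜 ε δ f) : f 1 = 0 := by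
  have h := hf.2 0 1 SetLike.GradedOne.one_mem 1
  rw [hbich.zero_right, one_smul, mul_one, mul_one, one_mul] at h
  exact left_eq_add.1 h

theorem DGraded.induction (hDgr : DGraded 𝒜 ε D) {p : Module.End F A → Prop}
    (hom : ∀ f δ, f ∈ D → IsColorDer 𝒜 ε δ f → p f) (zero : p 0)
    (add : ∀ f g, p f → p g → p (f + g)) (smul : ∀ (c : F) f, p f → p (c • f)) {f : Module.End F A}
    (hf : f ∈ D) : p f := by
  rw [hDgr] at hf
  induction hf using Submodule.span_induction with
  | zero => exact zero
  | add a b _ _ ha hb => exact add a b ha hb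
  | smul r a _ ha => exact smul r a ha
  | mem a ha => exact ha.2.elim fun δ h => hom a δ ha.1 h

theorem mem_F1_of_homogeneous (hDgr : DGraded 𝒜 ε D) {u : A}
    (h : ∀ f δ, f ∈ D → IsColorDer 𝒜 ε δ f → f u = 0) : u ∈ F1 D := fun f hf => by
  refine hDgr.induction (p := fun f => f u = 0) h rfl (fun f g hf hg => ?_) (fun c f hf => ?_) hf
  · rw [LinearMap.add_apply, hf, hg, add_zero]
  · rw [LinearMap.smul_apply, hf, smul_zero]

variable [GradedAlgebra 𝒜]

theorem component_mem_F1 (hDgr : DGraded 𝒜 ε D) {u : A} (hu : u ∈ F1 D) (l : Γ) :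
    component 𝒜 l u ∈ F1 D :=
  mem_F1_of_homogeneous hDgr fun f δ hf hfd => by
    rw [← hfd.1.component_apply, hu f hf, map_zero]

theorem one_mem_F1 (hbich : IsBichar ε) (hDgr : DGraded 𝒜 ε D) : (1 : A) ∈ F1 D :=
  mem_F1_of_homogeneous hDgr fun _ _ _ hfd => hfd.map_one hbich

theorem mul_mem_F1 (hDgr : DGraded 𝒜 ε D) {u v : A} (hu : u ∈ F1 D) (hv : v ∈ F1 D) :
    u * v ∈ F1 D := by
  obtain ⟨s, hs⟩ := exists_sum_component (𝒜 := 𝒜) u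
  rw [← hs, Finset.sum_mul]
  refine sum_mem fun l _ => mem_F1_of_homogeneous hDgr fun f δ hf hfd => ?_
  rw [hfd.2 l _ (component_mem l u), component_mem_F1 hDgr hu l f hf, hv f hf, zero_mul, mul_zero,
    smul_zero, add_zero]

theorem mulL_mem_AD (D : Submodule F (Module.End F A)) (a : A) : mulL F A a ∈ AD D :=
  Algebra.subset_adjoin (Or.inl ⟨a, rfl⟩)

theorem F1D_le_AD (D : Submodule F (Module.End F A)) : F1D D ≤ AD D :=
  Algebra.adjoin_mono (Set.union_subset_union_left _ (Set.image_subset_range _ _))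

theorem mem_F1D_of_mem {f : Module.End F A} (hf : f ∈ D) : f ∈ F1D D :=
  Algebra.subset_adjoin (Or.inr hf)

/-- Products of homogeneous elements of `F₁` and of `D`, together with their degrees. -/
inductive HomogWord (𝒜 : Γ → Submodule F A) (ε : Γ → Γ → F) (D : Submodule F (Module.End F A)) :
    Γ → Module.End F A → Prop
  | one : HomogWord 𝒜 ε D 0 1
  | coeff {l : Γ} {u : A} (hu : u ∈ F1 D) (hl : u ∈ 𝒜 l) : HomogWord 𝒜 ε D l (mulL F A u)
  | der {δ : Γ} {f : Module.End F A} (hf : f ∈ D) (hfd : IsColorDer 𝒜 ε δ f) :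
      HomogWord 𝒜 ε D δ f
  | mul {γ δ : Γ} {x y : Module.End F A} (hx : HomogWord 𝒜 ε D γ x) (hy : HomogWord 𝒜 ε D δ y) :
      HomogWord 𝒜 ε D (γ + δ) (x * y)

theorem HomogWord.isHomogMap {γ : Γ} {x : Module.End F A} (hx : HomogWord 𝒜 ε D γ x) :
    IsHomogMap 𝒜 γ x := by
  induction hx with
  | one => exact IsHomogMap.one
  | coeff _ hl => exact isHomogMap_mulL hl
  | der _ hfd => exact hfd.1
  | mul _ _ hx hy => exact hx.mul hy

theorem HomogWord.mem_F1D {γ : Γ} {x : Module.End F A} (hx : HomogWord 𝒜 ε D γ x) :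
    x ∈ F1D D := by
  induction hx with
  | one => exact one_mem _
  | coeff hu _ => exact Algebra.subset_adjoin (Or.inl ⟨_, hu, rfl⟩)
  | der hf _ => exact mem_F1D_of_mem hf
  | mul _ _ hx hy => exact mul_mem hx hy

theorem mem_span_homogWord (hDgr : DGraded 𝒜 ε D) {x : Module.End F A} (hx : x ∈ F1D D) :
    x ∈ Submodule.span F (Prod.snd '' {p : Γ × Module.End F A | HomogWord 𝒜 ε D p.1 p.2}) := by
  have key : ∀ {γ : Γ} {y : Module.End F A}, HomogWord 𝒜 ε D γ y →
      y ∈ Submodule.span F (Prod.snd '' {p : Γ × Module.End F A | HomogWord 𝒜 ε D p.1 p.2}) :=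
    fun {γ y} h => Submodule.subset_span ⟨(γ, y), h, rfl⟩
  induction hx using Algebra.adjoin_induction with
  | mem y hy =>
    rcases hy with ⟨u, hu, rfl⟩ | hy
    · obtain ⟨s, hs⟩ := exists_sum_component (𝒜 := 𝒜) u
      rw [← hs, map_sum]
      exact sum_mem fun l _ => key (.coeff (component_mem_F1 hDgr hu l) (component_mem l u))
    · exact hDgr.induction (fun f δ hf hfd => key (.der hf hfd)) (zero_mem _)
        (fun f g hf hg => add_mem hf hg) (fun c f hf => Submodule.smul_mem _ c hf) hy
  | algebraMap r =>
    rw [Algebra.algebraMap_eq_smul_one]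
    exact Submodule.smul_mem _ _ (key .one)
  | add y z _ _ hy hz => exact add_mem hy hz
  | mul y z _ _ hy hz =>
    refine Submodule.span_induction₂ (p := fun y z _ _ => y * z ∈ _) ?_ ?_ ?_ ?_ ?_ ?_ ?_ hy hz
    · rintro _ _ ⟨p, hp, rfl⟩ ⟨q, hq, rfl⟩
      exact key (HomogWord.mul hp hq)
    · intro z _; simp
    · intro y _; simp
    · intro a b c _ _ _ h h'; rw [add_mul]; exact add_mem h h'
    · intro a b c _ _ _ h h'; rw [mul_add]; exact add_mem h h'
    · intro r a b _ _ h; rw [smul_mul_assoc]; exact Submodule.smul_mem _ _ h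
    · intro r a b _ _ h; rw [mul_smul_comm]; exact Submodule.smul_mem _ _ h

theorem colorCommute_symm (hbich : IsBichar ε) {γ δ : Γ} {x y : Module.End F A}
    (h : x * y = ε γ δ • (y * x)) : y * x = ε δ γ • (x * y) := by
  rw [h, smul_smul, hbich.1, one_smul]

theorem colorCommute_mul_left (hbich : IsBichar ε) {γ γ' δ : Γ} {x x' y : Module.End F A}
    (h : x * y = ε γ δ • (y * x)) (h' : x' * y = ε γ' δ • (y * x')) :
    (x * x') * y = ε (γ + γ') δ • (y * (x * x')) := by
  rw [mul_assoc, h', mul_smul_comm, ← mul_assoc, h, smul_mul_assoc, smul_smul, mul_assoc,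
    hbich.add_left, mul_comm (ε γ δ)]

theorem colorCommute_one_left (hbich : IsBichar ε) {δ : Γ} (y : Module.End F A) :
    1 * y = ε 0 δ • (y * 1) := by
  rw [hbich.zero_left, one_smul, one_mul, mul_one]

theorem HomogWord.colorCommute (hbich : IsBichar ε) (hcomm : IsColorComm 𝒜 ε)
    (hDcc : DColorComm 𝒜 ε D) {γ δ : Γ} {x y : Module.End F A} (hx : HomogWord 𝒜 ε D γ x)
    (hy : HomogWord 𝒜 ε D δ y) : x * y = ε γ δ • (y * x) := by
  have hdc : ∀ {δ l f u}, f ∈ D → IsColorDer 𝒜 ε δ f → u ∈ F1 D → u ∈ 𝒜 l →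
      f * mulL F A u = ε δ l • (mulL F A u * f) := fun {δ l f u} hf hfd hu hl => by
    rw [hfd.mul_mulL hl, hu f hf, map_zero, zero_add]
  induction hx with
  | one => exact colorCommute_one_left hbich y
  | mul _ _ ih ih' => exact colorCommute_mul_left hbich ih ih'
  | coeff hu hl =>
    refine colorCommute_symm hbich ?_
    induction hy with
    | one => exact colorCommute_one_left hbich _
    | mul _ _ ih ih' => exact colorCommute_mul_left hbich ih ih'
    | coeff hu' hl' => exact mulL_mul_mulL hcomm hl' hl
    | der hf hfd => exact hdc hf hfd hu hl
  | der hf hfd =>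
    refine colorCommute_symm hbich ?_
    induction hy with
    | one => exact colorCommute_one_left hbich _
    | mul _ _ ih ih' => exact colorCommute_mul_left hbich ih ih'
    | coeff hu hl => exact colorCommute_symm hbich (hdc hf hfd hu hl)
    | der hf' hfd' => exact hDcc _ _ _ _ hf' hf hfd' hfd

theorem mem_span_homogWord_of_isHomogMap (hDgr : DGraded 𝒜 ε D) {γ : Γ} {x : Module.End F A}
    (hx : x ∈ F1D D) (hγ : IsHomogMap 𝒜 γ x) :
    x ∈ Submodule.span F {g | HomogWord 𝒜 ε D γ g} := by
  rw [← endComponent_same hγ]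
  exact endComponent_mem_span (fun p hp => HomogWord.isHomogMap hp) γ (mem_span_homogWord hDgr hx)

/-- Homogeneous elements of `F₁[D]` color-commute. -/
theorem F1D_colorCommute (hbich : IsBichar ε) (hcomm : IsColorComm 𝒜 ε) (hDgr : DGraded 𝒜 ε D)
    (hDcc : DColorComm 𝒜 ε D) {γ δ : Γ} {x y : Module.End F A} (hx : x ∈ F1D D)
    (hy : y ∈ F1D D) (hγ : IsHomogMap 𝒜 γ x) (hδ : IsHomogMap 𝒜 δ y) :
    x * y = ε γ δ • (y * x) := by
  refine Submodule.span_induction₂ (p := fun x y _ _ => x * y = ε γ δ • (y * x)) ?_ ?_ ?_ ?_ ?_ ?_ ?_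
    (mem_span_homogWord_of_isHomogMap hDgr hx hγ) (mem_span_homogWord_of_isHomogMap hDgr hy hδ)
  · intro x y hx hy
    exact HomogWord.colorCommute hbich hcomm hDcc hx hy
  · intro z _; simp
  · intro y _; simp
  · intro a b c _ _ _ h h'; rw [add_mul, mul_add, h, h', smul_add]
  · intro a b c _ _ _ h h'; rw [add_mul, mul_add, h, h', smul_add]
  · intro r a b _ _ h; rw [smul_mul_assoc, mul_smul_comm, h, smul_comm]
  · intro r a b _ _ h; rw [smul_mul_assoc, mul_smul_comm, h, smul_comm]

theorem endComponent_mem_F1D (hDgr : DGraded 𝒜 ε D) {x : Module.End F A} (hx : x ∈ F1D D) (γ : Γ) :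
    endComponent 𝒜 γ x ∈ F1D D := by
  have h := endComponent_mem_span (fun p hp => HomogWord.isHomogMap hp) γ
    (mem_span_homogWord hDgr hx)
  refine (Submodule.span_le (p := Subalgebra.toSubmodule (F1D D))).2 ?_ h
  exact fun g hg => HomogWord.mem_F1D hg

theorem isColorDer_endComponent {f : Module.End F A} (hf : f ∈ DerE 𝒜 ε) (γ : Γ) :
    IsColorDer 𝒜 ε γ (endComponent 𝒜 γ f) := by
  have hspan : f ∈ Submodule.span F
      (Prod.snd '' {p : Γ × Module.End F A | IsColorDer 𝒜 ε p.1 p.2}) := by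
    refine Submodule.span_mono ?_ hf
    rintro g ⟨δ, hg⟩
    exact ⟨(δ, g), hg, rfl⟩
  have h := endComponent_mem_span (fun p hp => hp.1) γ hspan
  generalize endComponent 𝒜 γ f = g at h
  induction h using Submodule.span_induction with
  | mem g hg => exact hg
  | zero => exact ⟨fun l a _ => zero_mem _, fun l a _ b => by simp⟩
  | add g g' _ _ hg hg' =>
    refine ⟨fun l a ha => add_mem (hg.1 l a ha) (hg'.1 l a ha), fun l a ha b => ?_⟩
    simp only [LinearMap.add_apply, hg.2 l a ha b, hg'.2 l a ha b, add_mul, mul_add, smul_add]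
    abel
  | smul r g _ hg =>
    refine ⟨fun l a ha => Submodule.smul_mem _ _ (hg.1 l a ha), fun l a ha b => ?_⟩
    simp only [LinearMap.smul_apply, hg.2 l a ha b, smul_mul_assoc, mul_smul_comm, smul_add,
      smul_comm r]

end Operators

/-! ### Consequences of graded `D`-simplicity -/

section Simple

variable {𝒜 : Γ → Submodule F A} [GradedAlgebra 𝒜] {ε : Γ → Γ → F}
  {D : Submodule F (Module.End F A)}

theorem span_homogeneous_induction {M : Type} [AddCommGroup M] [Module A M] {T : Set M}
    {p : M → Prop} (zero : p 0) (add : ∀ x y, p x → p y → p (x + y))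
    (smul : ∀ l, ∀ b ∈ 𝒜 l, ∀ v ∈ T, p (b • v)) {m : M} (hm : m ∈ Submodule.span A T) : p m := by
  suffices h : ∀ b : A, p (b • m) by simpa using h 1
  induction hm using Submodule.span_induction with
  | zero => simpa using zero
  | add x y _ _ hx hy => intro b; rw [smul_add]; exact add _ _ (hx b) (hy b)
  | smul r x _ hx => intro b; rw [smul_smul]; exact hx _
  | mem v hv =>
    intro b
    induction b using homogeneous_induction (𝒜 := 𝒜) with
    | hom l b hb => exact smul l b hb v hv
    | add b c hb hc => rw [add_smul]; exact add _ _ hb hc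

theorem apply_apply_of_mem (hbich : IsBichar ε) (hcomm : IsColorComm 𝒜 ε)
    (hDgr : DGraded 𝒜 ε D) (hDcc : DColorComm 𝒜 ε D) {θ δ : Γ} {d f : Module.End F A} (hd : d ∈ D)
    (hdd : IsColorDer 𝒜 ε θ d) (hf : f ∈ F1D D) (hfd : IsColorDer 𝒜 ε δ f) (a : A) :
    d (f a) = ε θ δ • f (d a) :=
  LinearMap.congr_fun
    (F1D_colorCommute hbich hcomm hDgr hDcc (mem_F1D_of_mem hd) hf hdd.1 hfd.1) a

theorem eq_bot_or_eq_top_of_homogeneous (hDgr : DGraded 𝒜 ε D) (hsimple : GradedDSimple 𝒜 D)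
    {J : Ideal A} (hJ : ∀ l, ∀ x ∈ J, component 𝒜 l x ∈ J)
    (hD : ∀ f δ, f ∈ D → IsColorDer 𝒜 ε δ f → ∀ x ∈ J, f x ∈ J) : J = ⊥ ∨ J = ⊤ := by
  refine hsimple J (fun l x hx => hJ l x hx) fun f hf => ?_
  refine hDgr.induction (p := fun f => ∀ x ∈ J, f x ∈ J) hD (fun x _ => zero_mem _)
    (fun f g hf hg x hx => add_mem (hf x hx) (hg x hx)) (fun c f hf x hx => ?_) hf
  rw [LinearMap.smul_apply, Algebra.smul_def]
  exact J.mul_mem_left _ (hf x hx)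

/-- The left ideal generated by the image of a nonzero homogeneous derivation in `F₁[D]` is `A`. -/
theorem span_image_eq_top (hbich : IsBichar ε) (hcomm : IsColorComm 𝒜 ε) (hDgr : DGraded 𝒜 ε D)
    (hDcc : DColorComm 𝒜 ε D) (hsimple : GradedDSimple 𝒜 D) {δ : Γ} {f : Module.End F A}
    (hf : f ∈ F1D D) (hfd : IsColorDer 𝒜 ε δ f) (hf0 : f ≠ 0) :
    Submodule.span A {x | ∃ l, ∃ a ∈ 𝒜 l, f a = x} = ⊤ := by
  set J : Ideal A := Submodule.span A {x | ∃ l, ∃ a ∈ 𝒜 l, f a = x} with hJ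
  have hmem : ∀ {l : Γ} {a : A}, a ∈ 𝒜 l → f a ∈ J := fun {l a} ha =>
    Submodule.subset_span ⟨l, a, ha, rfl⟩
  refine (eq_bot_or_eq_top_of_homogeneous hDgr hsimple ?_ ?_).resolve_left fun h => hf0 ?_
  · intro l x hx
    exact Ideal.homogeneous_span 𝒜 _
      (by rintro _ ⟨m, a, ha, rfl⟩; exact ⟨m + δ, hfd.1 m a ha⟩) l hx
  · intro d θ hd hdd x hx
    refine span_homogeneous_induction (𝒜 := 𝒜) (p := fun x => d x ∈ J) (by simp)
      (fun x y hx hy => by rw [map_add]; exact add_mem hx hy) ?_ hx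
    rintro l b hb _ ⟨m, a, ha, rfl⟩
    rw [smul_eq_mul, hdd.2 l b hb, apply_apply_of_mem hbich hcomm hDgr hDcc hd hdd hf hfd,
      ← smul_mul_assoc, mul_smul_comm, ← smul_mul_assoc]
    exact add_mem (J.mul_mem_left _ (hmem ha)) (J.mul_mem_left _ (hmem (hdd.1 m a ha)))
  · refine homogeneous_ext (𝒜 := 𝒜) fun l a ha => ?_
    have := hmem ha
    rwa [h] at this

/-- The `A`-submodule of `A × A` spanned by the pairs `(f v, g v)`, suitably rescaled. -/
def pairSpan (𝒜 : Γ → Submodule F A) (ε : Γ → Γ → F) (δ δ' : Γ) (f g : Module.End F A) :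
    Submodule A (A × A) :=
  Submodule.span A {p | ∃ l, ∃ v ∈ 𝒜 l, p = (ε l δ • f v, ε l δ' • g v)}

theorem mem_pairSpan {l δ δ' : Γ} {f g : Module.End F A} {v : A} (hv : v ∈ 𝒜 l) :
    (ε l δ • f v, ε l δ' • g v) ∈ pairSpan 𝒜 ε δ δ' f g :=
  Submodule.subset_span ⟨l, v, hv, rfl⟩

theorem component_mem_pairSpan {δ δ' : Γ} {f g : Module.End F A} (hf : IsHomogMap 𝒜 δ f)
    (hg : IsHomogMap 𝒜 δ' g) (l : Γ) {p : A × A} (hp : p ∈ pairSpan 𝒜 ε δ δ' f g) :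
    (component 𝒜 (l + δ) p.1, component 𝒜 (l + δ') p.2) ∈ pairSpan 𝒜 ε δ δ' f g := by
  refine span_homogeneous_induction (𝒜 := 𝒜) (p := fun p : A × A =>
    (component 𝒜 (l + δ) p.1, component 𝒜 (l + δ') p.2) ∈ pairSpan 𝒜 ε δ δ' f g) ?_ ?_ ?_ hp
  · simp only [Prod.fst_zero, Prod.snd_zero, map_zero]
    exact zero_mem _
  · intro x y hx hy
    simpa using add_mem hx hy
  · rintro m b hb _ ⟨n, v, hv, rfl⟩
    have h1 : b * ε n δ • f v ∈ 𝒜 (m + n + δ) := by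
      rw [add_assoc]
      exact SetLike.mul_mem_graded hb (Submodule.smul_mem _ _ (hf n v hv))
    have h2 : b * ε n δ' • g v ∈ 𝒜 (m + n + δ') := by
      rw [add_assoc]
      exact SetLike.mul_mem_graded hb (Submodule.smul_mem _ _ (hg n v hv))
    simp only [Prod.smul_mk, smul_eq_mul]
    rcases eq_or_ne (m + n) l with rfl | h
    · rw [component_same h1, component_same h2]
      exact Submodule.smul_mem _ b (mem_pairSpan hv)
    · rw [component_ne h1 fun h' => h (add_right_cancel h'),
        component_ne h2 fun h' => h (add_right_cancel h')]
      exact zero_mem _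

theorem map_mem_pairSpan (hbich : IsBichar ε) (hcomm : IsColorComm 𝒜 ε)
    (hDgr : DGraded 𝒜 ε D) (hDcc : DColorComm 𝒜 ε D) {θ δ δ' : Γ} {d f g : Module.End F A}
    (hd : d ∈ D) (hdd : IsColorDer 𝒜 ε θ d) (hf : f ∈ F1D D) (hfd : IsColorDer 𝒜 ε δ f)
    (hg : g ∈ F1D D) (hgd : IsColorDer 𝒜 ε δ' g) {p : A × A}
    (hp : p ∈ pairSpan 𝒜 ε δ δ' f g) : (d p.1, d p.2) ∈ pairSpan 𝒜 ε δ δ' f g := by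
  refine span_homogeneous_induction (𝒜 := 𝒜) (p := fun p : A × A =>
    (d p.1, d p.2) ∈ pairSpan 𝒜 ε δ δ' f g) ?_ ?_ ?_ hp
  · simp only [Prod.fst_zero, Prod.snd_zero, map_zero]
    exact zero_mem _
  · intro x y hx hy
    simpa using add_mem hx hy
  · rintro m b hb _ ⟨n, v, hv, rfl⟩
    have h1 := mem_pairSpan (ε := ε) (δ := δ) (δ' := δ') (f := f) (g := g) hv
    have h2 := mem_pairSpan (ε := ε) (δ := δ) (δ' := δ') (f := f) (g := g) (hdd.1 n v hv)
    have h3 := add_mem (Submodule.smul_mem _ (d b) h1) (Submodule.smul_mem _ (ε θ m • b) h2)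
    convert h3 using 1
    simp only [Prod.smul_mk, smul_eq_mul, Prod.mk_add_mk, hdd.2 m b hb, map_smul,
      apply_apply_of_mem hbich hcomm hDgr hDcc hd hdd hf hfd,
      apply_apply_of_mem hbich hcomm hDgr hDcc hd hdd hg hgd, hbich.add_left, smul_mul_assoc,
      smul_smul]

/-- Either the pairs `(f v, g v)` separate the coordinates, or `g` is an `F₁`-multiple of `f`. -/
theorem zero_one_mem_pairSpan_or (hbich : IsBichar ε) (hcomm : IsColorComm 𝒜 ε)
    (hDgr : DGraded 𝒜 ε D) (hDcc : DColorComm 𝒜 ε D) (hsimple : GradedDSimple 𝒜 D)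
    {δ δ' : Γ} {f g : Module.End F A} (hf : f ∈ F1D D) (hfd : IsColorDer 𝒜 ε δ f) (hf0 : f ≠ 0)
    (hg : g ∈ F1D D) (hgd : IsColorDer 𝒜 ε δ' g) :
    ((0, 1) : A × A) ∈ pairSpan 𝒜 ε δ δ' f g ∨ ∃ c ∈ F1 D, g = mulL F A c * f := by
  set M := pairSpan 𝒜 ε δ δ' f g with hM
  let J : Ideal A := M.comap (LinearMap.inr A A A)
  have hJ : ∀ {x : A}, x ∈ J ↔ (0, x) ∈ M := Iff.rfl
  have hJ' : J = ⊥ ∨ J = ⊤ := by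
    refine eq_bot_or_eq_top_of_homogeneous hDgr hsimple ?_ ?_
    · intro l x hx
      have h := component_mem_pairSpan hfd.1 hgd.1 (l - δ') (hJ.1 hx)
      rwa [map_zero, sub_add_cancel] at h
    · intro d θ hd hdd x hx
      have h := map_mem_pairSpan hbich hcomm hDgr hDcc hd hdd hf hfd hg hgd (hJ.1 hx)
      rwa [map_zero] at h
  rcases hJ' with h | h
  swap
  · left
    rw [← hJ, h]
    trivial
  have hzero : ∀ {x : A}, (0, x) ∈ M → x = 0 := fun {x} hx => by
    have := hJ.2 hx
    rwa [h] at this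
  right
  have htop : (M.map (LinearMap.fst A A A)) = ⊤ := by
    rw [eq_top_iff, ← span_image_eq_top hbich hcomm hDgr hDcc hsimple hf hfd hf0,
      Submodule.span_le]
    rintro _ ⟨l, v, hv, rfl⟩
    refine ⟨algebraMap F A (ε l δ)⁻¹ • (ε l δ • f v, ε l δ' • g v),
      M.smul_mem _ (mem_pairSpan hv), ?_⟩
    simp only [LinearMap.fst_apply, Prod.smul_mk, smul_eq_mul, ← Algebra.smul_def]
    rw [inv_smul_smul₀ (hbich.ne_zero l δ)]
  have h1 : (1 : A) ∈ M.map (LinearMap.fst A A A) := by rw [htop]; trivial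
  obtain ⟨⟨_, c₀⟩, hc₀, rfl⟩ := h1
  have hc := component_mem_pairSpan hfd.1 hgd.1 (-δ) hc₀
  rw [neg_add_cancel, component_same SetLike.GradedOne.one_mem] at hc
  have hcm := component_mem (𝒜 := 𝒜) (-δ + δ') c₀
  simp only at hc
  generalize component 𝒜 (-δ + δ') c₀ = c at hc hcm
  have hcF : c ∈ F1 D := mem_F1_of_homogeneous hDgr fun d θ hd hdd => by
    have h := map_mem_pairSpan hbich hcomm hDgr hDcc hd hdd hf hfd hg hgd hc
    rw [hdd.map_one hbich] at h
    exact hzero h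
  refine ⟨ε δ (-δ + δ') • c, Submodule.smul_mem _ _ hcF, ?_⟩
  refine homogeneous_ext (𝒜 := 𝒜) fun l v hv => ?_
  have hv1 := sub_mem (mem_pairSpan (ε := ε) (δ := δ) (δ' := δ') (f := f) (g := g) hv)
    (Submodule.smul_mem _ (ε l δ • f v) hc)
  rw [Prod.smul_mk, Prod.mk_sub_mk, smul_eq_mul, smul_eq_mul, mul_one, sub_self] at hv1
  have hv2 := sub_eq_zero.1 (hzero hv1)
  rw [smul_mul_assoc, hcomm _ _ _ (hfd.1 l v hv) _ hcm, smul_smul, hbich.add_left,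
    ← mul_assoc, ← hbich.2, add_neg_cancel_left, mul_smul] at hv2
  rw [Module.End.mul_apply, mulL_apply, smul_mul_assoc]
  exact smul_right_injective A (hbich.ne_zero l δ') hv2

end Simple

/-! ### The derived space -/

section Derived

variable {𝒜 : Γ → Submodule F A} [GradedAlgebra 𝒜] {ε : Γ → Γ → F}
  {D : Submodule F (Module.End F A)}

theorem bracket_mem_Wsub {γ δ : Γ} {x y : Module.End F A} (hx : x ∈ AD D) (hy : y ∈ AD D)
    (hγ : IsHomogMap 𝒜 γ x) (hδ : IsHomogMap 𝒜 δ y) : x * y - ε γ δ • (y * x) ∈ Wsub 𝒜 ε D :=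
  Submodule.subset_span ⟨γ, δ, x, y, hx, hy, hγ, hδ, rfl⟩

theorem mulL_mul_apply_mem_Wsub (hbich : IsBichar ε) (hcomm : IsColorComm 𝒜 ε)
    {δ l m : Γ} {f : Module.End F A} (hf : f ∈ F1D D) (hfd : IsColorDer 𝒜 ε δ f) {a b : A}
    (ha : a ∈ 𝒜 l) (hb : b ∈ 𝒜 m) : mulL F A (b * f a) ∈ Wsub 𝒜 ε D := by
  have h := bracket_mem_Wsub (ε := ε) (mul_mem (mulL_mem_AD D b) (F1D_le_AD D hf))
    (mulL_mem_AD D a) ((isHomogMap_mulL hb).mul hfd.1) (isHomogMap_mulL ha)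
  convert h using 1
  rw [mul_assoc, hfd.mul_mulL ha, mul_add, ← mulL_mul, mul_smul_comm, ← mul_assoc,
    ← mul_assoc, mulL_mul_mulL hcomm ha hb, smul_mul_assoc, smul_smul, hbich.add_left,
    mul_right_comm, hbich.1, one_mul, add_sub_cancel_right]

theorem mulL_mem_Wsub (hbich : IsBichar ε) (hcomm : IsColorComm 𝒜 ε) (hDgr : DGraded 𝒜 ε D)
    (hDcc : DColorComm 𝒜 ε D) (hsimple : GradedDSimple 𝒜 D) {δ : Γ} {f : Module.End F A}
    (hf : f ∈ F1D D) (hfd : IsColorDer 𝒜 ε δ f) (hf0 : f ≠ 0) (a : A) :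
    mulL F A a ∈ Wsub 𝒜 ε D := by
  have ha : a ∈ Submodule.span A {x | ∃ l, ∃ a ∈ 𝒜 l, f a = x} := by
    rw [span_image_eq_top hbich hcomm hDgr hDcc hsimple hf hfd hf0]; trivial
  refine span_homogeneous_induction (𝒜 := 𝒜) (p := fun a => mulL F A a ∈ Wsub 𝒜 ε D) ?_ ?_ ?_ ha
  · rw [map_zero]; exact zero_mem _
  · intro x y hx hy; rw [map_add]; exact add_mem hx hy
  · rintro l b hb _ ⟨m, v, hv, rfl⟩
    exact mulL_mul_apply_mem_Wsub hbich hcomm hf hfd hv hb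

/-- The skew relation between `b f(a) g` and `b g(a) f` modulo `W`. -/
theorem skew_mem_Wsub (hbich : IsBichar ε) (hcomm : IsColorComm 𝒜 ε)
    (hA : ∀ a, mulL F A a ∈ Wsub 𝒜 ε D) {δ δ' l m : Γ} {f g : Module.End F A} (hf : f ∈ F1D D)
    (hfd : IsColorDer 𝒜 ε δ f) (hg : g ∈ F1D D) (hgd : IsColorDer 𝒜 ε δ' g) {a b : A}
    (ha : a ∈ 𝒜 l) (hb : b ∈ 𝒜 m) :
    mulL F A (b * ε l δ • f a) * g + ε δ δ' • (mulL F A (b * ε l δ' • g a) * f) ∈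
      Wsub 𝒜 ε D := by
  have h := bracket_mem_Wsub (ε := ε)
    (mul_mem (mulL_mem_AD D b) (mul_mem (F1D_le_AD D hf) (F1D_le_AD D hg)))
    (mulL_mem_AD D a) ((isHomogMap_mulL hb).mul (hfd.1.mul hgd.1)) (isHomogMap_mulL ha)
  have h' := Submodule.smul_mem _ (ε l δ * ε l δ') (sub_mem h (hA (b * f (g a))))
  convert h' using 1
  have e1 : mulL F A b * (f * g) * mulL F A a = mulL F A (b * f (g a)) +
      (ε δ l * ε δ δ') • (mulL F A (b * g a) * f) + ε δ' l • (mulL F A (b * f a) * g) +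
      (ε δ l * ε δ' l) • (mulL F A b * mulL F A a * (f * g)) := by
    have : f * g * mulL F A a = mulL F A (f (g a)) + (ε δ l * ε δ δ') • (mulL F A (g a) * f) +
        ε δ' l • (mulL F A (f a) * g) + (ε δ l * ε δ' l) • (mulL F A a * (f * g)) := by
      rw [mul_assoc, hgd.mul_mulL ha, mul_add, hfd.mul_mulL (hgd.1 l a ha), mul_smul_comm,
        ← mul_assoc f, hfd.mul_mulL ha, add_mul, smul_add, smul_mul_assoc, smul_smul, hbich.2,
        mul_assoc, mul_comm (ε δ' l) (ε δ l), ← add_assoc]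
    rw [mul_assoc, this]
    simp only [mul_add, mul_smul_comm, mulL_mul, mul_assoc]
  have e2 : ε (m + (δ + δ')) l • (mulL F A a * (mulL F A b * (f * g))) =
      (ε δ l * ε δ' l) • (mulL F A b * mulL F A a * (f * g)) := by
    rw [← mul_assoc, mulL_mul_mulL hcomm ha hb, smul_mul_assoc, smul_smul, hbich.add_left,
      hbich.add_left, mul_right_comm, hbich.1, one_mul]
  have e3 : ε l δ * ε l δ' * (ε δ l * ε δ δ') = ε δ δ' * ε l δ' := by
    linear_combination (ε l δ' * ε δ δ') * hbich.1 l δ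
  have e4 : ε l δ * ε l δ' * ε δ' l = ε l δ := by
    linear_combination ε l δ * hbich.1 l δ'
  rw [e1, e2, add_sub_cancel_right, add_assoc, add_sub_cancel_left, smul_add, smul_smul, smul_smul,
    e3, e4, mul_smul_comm, mul_smul_comm, map_smul, map_smul, smul_mul_assoc, smul_mul_assoc,
    smul_smul, add_comm]

theorem pairSpan_mem_Wsub (hbich : IsBichar ε) (hcomm : IsColorComm 𝒜 ε)
    (hA : ∀ a, mulL F A a ∈ Wsub 𝒜 ε D) {δ δ' : Γ} {f g : Module.End F A} (hf : f ∈ F1D D)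
    (hfd : IsColorDer 𝒜 ε δ f) (hg : g ∈ F1D D) (hgd : IsColorDer 𝒜 ε δ' g) {p : A × A}
    (hp : p ∈ pairSpan 𝒜 ε δ δ' f g) :
    mulL F A p.1 * g + ε δ δ' • (mulL F A p.2 * f) ∈ Wsub 𝒜 ε D := by
  refine span_homogeneous_induction (𝒜 := 𝒜) (p := fun p : A × A =>
    mulL F A p.1 * g + ε δ δ' • (mulL F A p.2 * f) ∈ Wsub 𝒜 ε D) ?_ ?_ ?_ hp
  · simp
  · intro x y hx hy
    convert add_mem hx hy using 1
    simp only [Prod.fst_add, Prod.snd_add, map_add, add_mul, smul_add]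
    abel
  · rintro l b hb _ ⟨m, v, hv, rfl⟩
    exact skew_mem_Wsub hbich hcomm hA hf hfd hg hgd hv hb

theorem mul_mem_Wsub_or_eq (hbich : IsBichar ε) (hcomm : IsColorComm 𝒜 ε)
    (hDgr : DGraded 𝒜 ε D) (hDcc : DColorComm 𝒜 ε D) (hsimple : GradedDSimple 𝒜 D)
    {δ δ' : Γ} {f g : Module.End F A} (hf : f ∈ F1D D) (hfd : IsColorDer 𝒜 ε δ f) (hf0 : f ≠ 0)
    (hg : g ∈ F1D D) (hgd : IsColorDer 𝒜 ε δ' g) :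
    (∀ a, mulL F A a * f ∈ Wsub 𝒜 ε D) ∨ ∃ c ∈ F1 D, g = mulL F A c * f := by
  refine (zero_one_mem_pairSpan_or hbich hcomm hDgr hDcc hsimple hf hfd hf0 hg hgd).imp_left
    fun h a => ?_
  have h' := pairSpan_mem_Wsub hbich hcomm
    (mulL_mem_Wsub hbich hcomm hDgr hDcc hsimple hf hfd hf0) hf hfd hg hgd
    (Submodule.smul_mem _ a h)
  rw [Prod.smul_mk, smul_zero, smul_eq_mul, mul_one, map_zero, zero_mul, zero_add] at h'
  exact (Submodule.smul_mem_iff _ (hbich.ne_zero δ δ')).1 h'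

theorem mul_mem_Wsub_of_mul_apply_mem (hbich : IsBichar ε) (hcomm : IsColorComm 𝒜 ε)
    (hDgr : DGraded 𝒜 ε D) (hDcc : DColorComm 𝒜 ε D) (hsimple : GradedDSimple 𝒜 D) {δ : Γ}
    {f g : Module.End F A} (hf : f ∈ F1D D) (hfd : IsColorDer 𝒜 ε δ f) (hf0 : f ≠ 0)
    (h : ∀ l, ∀ a ∈ 𝒜 l, ∀ m, ∀ b ∈ 𝒜 m, mulL F A (b * f a) * g ∈ Wsub 𝒜 ε D) (a : A) :
    mulL F A a * g ∈ Wsub 𝒜 ε D := by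
  have ha : a ∈ Submodule.span A {x | ∃ l, ∃ a ∈ 𝒜 l, f a = x} := by
    rw [span_image_eq_top hbich hcomm hDgr hDcc hsimple hf hfd hf0]; trivial
  refine span_homogeneous_induction (𝒜 := 𝒜) (p := fun a => mulL F A a * g ∈ Wsub 𝒜 ε D)
    ?_ ?_ ?_ ha
  · simp
  · intro x y hx hy; rw [map_add, add_mul]; exact add_mem hx hy
  · rintro l b hb _ ⟨m, v, hv, rfl⟩
    exact h m v hv l b hb

/-- A nonzero derivation of even degree in `F₁[D]` forces `A g ⊆ W` for all derivations `g`. -/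
theorem mul_mem_Wsub_of_even (hchar : (2 : F) ≠ 0) (hbich : IsBichar ε) (hcomm : IsColorComm 𝒜 ε)
    (hDgr : DGraded 𝒜 ε D) (hDcc : DColorComm 𝒜 ε D) (hsimple : GradedDSimple 𝒜 D)
    {δ δ' : Γ} {f g : Module.End F A} (hf : f ∈ F1D D) (hfd : IsColorDer 𝒜 ε δ f) (hf0 : f ≠ 0)
    (heven : ε δ δ = 1) (hg : g ∈ F1D D) (hgd : IsColorDer 𝒜 ε δ' g) (a : A) :
    mulL F A a * g ∈ Wsub 𝒜 ε D := by
  have hA := mulL_mem_Wsub hbich hcomm hDgr hDcc hsimple hf hfd hf0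
  have hAf : ∀ a, mulL F A a * f ∈ Wsub 𝒜 ε D := by
    refine mul_mem_Wsub_of_mul_apply_mem hbich hcomm hDgr hDcc hsimple hf hfd hf0 ?_
    intro l a ha m b hb
    have h := skew_mem_Wsub hbich hcomm hA hf hfd hf hfd ha hb
    rw [heven, one_smul, ← two_smul F, Submodule.smul_mem_iff _ hchar, mul_smul_comm, map_smul,
      smul_mul_assoc, Submodule.smul_mem_iff _ (hbich.ne_zero l δ)] at h
    exact h
  refine mul_mem_Wsub_of_mul_apply_mem hbich hcomm hDgr hDcc hsimple hf hfd hf0 ?_ a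
  intro l a ha m b hb
  have h := skew_mem_Wsub hbich hcomm hA hf hfd hg hgd ha hb
  rw [Submodule.add_mem_iff_left _ (Submodule.smul_mem _ _ (hAf _)), mul_smul_comm, map_smul,
    smul_mul_assoc, Submodule.smul_mem_iff _ (hbich.ne_zero l δ)] at h
  exact h

/-- Any two elements of `F₁` satisfy a nontrivial left linear relation over `F₁`. -/
theorem exists_F1_relation [Nontrivial A] (hbich : IsBichar ε) (hcomm : IsColorComm 𝒜 ε)
    (hDgr : DGraded 𝒜 ε D) {c₁ c₂ : A} (h₁ : c₁ ∈ F1 D) (h₂ : c₂ ∈ F1 D) :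
    ∃ x ∈ F1 D, ∃ y ∈ F1 D, x * c₁ + y * c₂ = 0 ∧ ¬(x = 0 ∧ y = 0) := by
  obtain ⟨s₁, hs₁⟩ := exists_sum_component (𝒜 := 𝒜) c₁
  obtain ⟨s₂, hs₂⟩ := exists_sum_component (𝒜 := 𝒜) c₂
  let t : s₁ ⊕ s₂ → A :=
    Sum.elim (fun l => component 𝒜 (l : Γ) c₁) (fun l => component 𝒜 (l : Γ) c₂)
  let deg : s₁ ⊕ s₂ → Γ := Sum.elim (fun l => l) (fun l => l)
  have hdeg : ∀ i, t i ∈ 𝒜 (deg i) := by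
    rintro (l | l)
    · exact component_mem _ _
    · exact component_mem _ _
  have htF : ∀ i, t i ∈ F1 D := by
    rintro (l | l)
    · exact component_mem_F1 hDgr h₁ _
    · exact component_mem_F1 hDgr h₂ _
  have hc₁ : c₁ ∈ Submodule.span F (Set.range t) := by
    rw [← hs₁]
    exact sum_mem fun l hl => Submodule.subset_span ⟨Sum.inl ⟨l, hl⟩, rfl⟩
  have hc₂ : c₂ ∈ Submodule.span F (Set.range t) := by
    rw [← hs₂]
    exact sum_mem fun l hl => Submodule.subset_span ⟨Sum.inr ⟨l, hl⟩, rfl⟩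
  have hpow : ∀ i (k : ℕ), t i ^ k ∈ F1 D := by
    intro i k
    induction k with
    | zero => rw [pow_zero]; exact one_mem_F1 hbich hDgr
    | succ k ih => rw [pow_succ]; exact mul_mem_F1 hDgr ih (htF i)
  have hlist : ∀ (L : List (s₁ ⊕ s₂)) α, listMonomial t L α ∈ F1 D := by
    intro L α
    induction L with
    | nil => exact one_mem_F1 hbich hDgr
    | cons i L ih => exact mul_mem_F1 hDgr (hpow i (α i)) ih
  have hspan : ∀ n, monomialSpan F t n ≤ F1 D := fun n => Submodule.span_le.2 <| by
    rintro _ ⟨α, rfl⟩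
    exact hlist _ _
  obtain ⟨n, x, hx, y, hy, h⟩ := exists_left_relation
    (fun i j => hcomm _ _ _ (hdeg i) _ (hdeg j)) hc₁ hc₂
  exact ⟨x, hspan n hx, y, hspan n hy, h⟩

/-- If all homogeneous elements of `𝒟` are `F₁`-multiples of `p`, then so are all elements. -/
theorem exists_eq_mulL_mul (hDgr : DGraded 𝒜 ε D) {p : Module.End F A}
    (h : ∀ g δ, g ∈ F1D D → IsColorDer 𝒜 ε δ g → ∃ c ∈ F1 D, g = mulL F A c * p)
    {f : Module.End F A} (hf : f ∈ DScr 𝒜 ε D) : ∃ c ∈ F1 D, f = mulL F A c * p := by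
  obtain ⟨s, hs⟩ := exists_sum_endComponent (fun q hq => HomogWord.isHomogMap hq)
    (mem_span_homogWord hDgr hf.1)
  choose c hc hcp using fun γ => h (endComponent 𝒜 γ f) γ (endComponent_mem_F1D hDgr hf.1 γ)
    (isColorDer_endComponent hf.2 γ)
  refine ⟨∑ γ ∈ s, c γ, sum_mem fun γ _ => hc γ, ?_⟩
  rw [map_sum, Finset.sum_mul, ← hs]
  refine Finset.sum_congr rfl fun γ _ => hcp γ

end Derived

theorem stmt_9
    (𝒜 : Γ → Submodule F A) [GradedAlgebra 𝒜] (ε : Γ → Γ → F)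
    (D : Submodule F (Module.End F A))
    (hchar : (2 : F) ≠ 0)
    (hbich : IsBichar ε)
    (hcomm : IsColorComm 𝒜 ε)
    (hDder : D ≤ DerE 𝒜 ε)
    (hDgr : DGraded 𝒜 ε D)
    (hDcc : DColorComm 𝒜 ε D)
    (hDne : D ≠ ⊥)
    (hsimple : GradedDSimple 𝒜 D)
    (hdim :
      (∃ f g : Module.End F A, f ∈ DScr 𝒜 ε D ∧ g ∈ DScr 𝒜 ε D ∧
        ∀ c₁ c₂ : A, c₁ ∈ F1 D → c₂ ∈ F1 D →
          mulL F A c₁ * f + mulL F A c₂ * g = 0 → c₁ = 0 ∧ c₂ = 0) ∨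
      (∃ (f : Module.End F A) (δ : Γ), f ∈ DScr 𝒜 ε D ∧ f ≠ 0 ∧
        IsColorDer 𝒜 ε δ f ∧ ε δ δ = 1)) :
    ∀ (pd : Module.End F A) (δ : Γ), pd ∈ DScr 𝒜 ε D → IsColorDer 𝒜 ε δ pd →
      ∀ a : A, mulL F A a * pd ∈ Wsub 𝒜 ε D := by

  intro pd δ hpd hpdd
  rcases hdim with ⟨f, g, hf, hg, hind⟩ | ⟨f, δ', hf, hf0, hfd, heven⟩
  · rcases eq_or_ne pd 0 with rfl | hpd0
    · simp
    by_contra hcon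
    have hmul : ∀ g δ, g ∈ F1D D → IsColorDer 𝒜 ε δ g → ∃ c ∈ F1 D, g = mulL F A c * pd :=
      fun g δ' hg hgd =>
        (mul_mem_Wsub_or_eq hbich hcomm hDgr hDcc hsimple hpd.1 hpdd hpd0 hg hgd).resolve_left hcon
    obtain ⟨c₁, hc₁, rfl⟩ := exists_eq_mulL_mul hDgr hmul hf
    obtain ⟨c₂, hc₂, rfl⟩ := exists_eq_mulL_mul hDgr hmul hg
    have : Nontrivial A := by
      by_contra hA
      rw [not_nontrivial_iff_subsingleton] at hA
      exact hpd0 (LinearMap.ext fun a => Subsingleton.elim _ _)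
    obtain ⟨x, hx, y, hy, hxy, hne⟩ := exists_F1_relation hbich hcomm hDgr hc₁ hc₂
    refine hne (hind x y hx hy ?_)
    rw [← mul_assoc, ← mul_assoc, ← mulL_mul, ← mulL_mul, ← add_mul, ← map_add, hxy, map_zero,
      zero_mul]
  · exact mul_mem_Wsub_of_even hchar hbich hcomm hDgr hDcc hsimple hf.1 hfd hf0 heven hpd.1 hpdd
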